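/- There exists a universal constant C such that: for every δ ∈ (0,1), every (u₀,u₁) ∈ Ḣ¹×L² satisfying ‖(u₀,u₁)‖_{Ḣ¹×L²(B₁₊δᶜ ∪ B₁₋δ)} ≤ δ‖(u₀,u₁)‖_{Ḣ¹×L²}, and every k₀ ∈ ℤ with 2^{−k₀} ∈ [δ^{1/6}, 2δ^{1/6}], one has ‖P_{≤k₀}(∇u₀, u₁)‖_{L²×L²} ≤ C δ^{1/3} ‖(u₀,u₁)‖_{Ḣ¹×L²}. -/

import Mathlib

noncomputable section

open MeasureTheory Metric Set Filter FourierTransform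

abbrev E2 : Type := EuclideanSpace ℝ (Fin 2)
abbrev E3 : Type := EuclideanSpace ℝ (Fin 3)

def sb (i : Fin 2) : E2 := EuclideanSpace.single i 1
def pd (f : E2 → E3) (i : Fin 2) (x : E2) : E3 := fderiv ℝ f x (sb i)
def gradSq (f : E2 → E3) (x : E2) : ℝ := ∑ i : Fin 2, ‖pd f i x‖ ^ 2

def HLnormSq (f g : E2 → E3) (s : Set E2) : ℝ :=
  ∫ x in s, (gradSq f x + ‖g x‖ ^ 2)

def HLnorm (f g : E2 → E3) (s : Set E2) : ℝ := Real.sqrt (HLnormSq f g s)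

/-- `Φ̌`, the (real) inverse Fourier transform of the real, even function `Φ` -/
def loKer (Φ : E2 → ℝ) (y : E2) : ℝ := (𝓕⁻ (fun ξ : E2 => (Φ ξ : ℂ)) y).re

/-- the low-frequency projection `P_{≤k₀}`, the Fourier multiplier with symbol
`Φ(ξ/2^{k₀})`, i.e. convolution with `4^{k₀} Φ̌(2^{k₀}·)` -/
def Plow (Φ : E2 → ℝ) (k₀ : ℤ) (f : E2 → E3) (x : E2) : E3 :=
  ∫ y : E2, ((4:ℝ) ^ k₀ * loKer Φ ((2:ℝ) ^ k₀ • y)) • f (x - y)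

open scoped ENNReal in
/-- Cauchy–Schwarz for the lower Lebesgue integral, in squared form. -/
lemma sq_lintegral_mul_le {α : Type*} [MeasurableSpace α] {μ : Measure α} {f g : α → ℝ≥0∞}
    (hf : AEMeasurable f μ) (hg : AEMeasurable g μ) :
    (∫⁻ a, f a * g a ∂μ) ^ 2 ≤ (∫⁻ a, f a ^ 2 ∂μ) * ∫⁻ a, g a ^ 2 ∂μ := by
  have h := ENNReal.lintegral_mul_le_Lp_mul_Lq μ Real.HolderConjugate.two_two hf hg
  simp only [Pi.mul_apply, ENNReal.rpow_two] at h
  have hs : ∀ x : ℝ≥0∞, (x ^ ((1:ℝ) / 2)) ^ 2 = x := fun x => by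
    rw [← ENNReal.rpow_natCast, ← ENNReal.rpow_mul]
    norm_num
  calc _ ≤ _ := pow_le_pow_left' h 2
    _ = _ := by rw [mul_pow, hs, hs]

open scoped ENNReal in
lemma sq_lintegral_mul_le_weight {α : Type*} [MeasurableSpace α] {μ : Measure α}
    {w g : α → ℝ≥0∞} (hw : AEMeasurable w μ) (hg : AEMeasurable g μ) :
    (∫⁻ a, w a * g a ∂μ) ^ 2 ≤ (∫⁻ a, w a ∂μ) * ∫⁻ a, w a * g a ^ 2 ∂μ := by
  have hs : ∀ x : ℝ≥0∞, (x ^ ((1:ℝ) / 2)) ^ 2 = x := fun x => by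
    rw [← ENNReal.rpow_natCast, ← ENNReal.rpow_mul]
    norm_num
  have h := sq_lintegral_mul_le (hw.pow_const ((1:ℝ) / 2)) ((hw.pow_const ((1:ℝ) / 2)).mul hg)
  simpa only [Pi.mul_apply, ← mul_assoc, ← pow_two, mul_pow, hs] using h

open scoped ENNReal in
/-- Young's inequality `‖a ∗ b‖₂ ≤ ‖a‖₁ ‖b‖₂` for nonnegative functions, in squared form. -/
lemma lintegral_sq_conv_le {a b : E2 → ℝ≥0∞} (ha : AEMeasurable a) (hb : AEMeasurable b) :
    ∫⁻ x, (∫⁻ y, a y * b (x - y)) ^ 2 ≤ (∫⁻ y, a y) ^ 2 * ∫⁻ y, b y ^ 2 := by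
  have hb' : ∀ x : E2, AEMeasurable (fun y => b (x - y)) := fun x =>
    hb.comp_quasiMeasurePreserving (quasiMeasurePreserving_sub_left_of_right_invariant volume x)
  have hprod : AEMeasurable (Function.uncurry fun x y : E2 => a y * b (x - y) ^ 2)
      (volume.prod volume) :=
    (ha.comp_quasiMeasurePreserving Measure.quasiMeasurePreserving_snd).mul
      ((hb.comp_quasiMeasurePreserving
        (quasiMeasurePreserving_sub_of_right_invariant volume volume)).pow_const 2)
  calc ∫⁻ x, (∫⁻ y, a y * b (x - y)) ^ 2
      ≤ ∫⁻ x, (∫⁻ y, a y) * ∫⁻ y, a y * b (x - y) ^ 2 :=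
        lintegral_mono fun x => sq_lintegral_mul_le_weight ha (hb' x)
    _ = (∫⁻ y, a y) * ∫⁻ x, ∫⁻ y, a y * b (x - y) ^ 2 :=
        lintegral_const_mul'' _ hprod.lintegral_prod_right'
    _ = (∫⁻ y, a y) * ∫⁻ y, ∫⁻ x, a y * b (x - y) ^ 2 := by
        rw [lintegral_lintegral_swap hprod]
    _ = (∫⁻ y, a y) * ∫⁻ y, a y * ∫⁻ x, b x ^ 2 := by
        congr 1
        refine lintegral_congr fun y => ?_
        have hby : AEMeasurable (fun x => b (x - y)) :=
          hb.comp_quasiMeasurePreserving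
            (measurePreserving_sub_right volume y).quasiMeasurePreserving
        rw [lintegral_const_mul'' _ (hby.pow_const 2),
          lintegral_sub_right_eq_self (fun x => b x ^ 2) y]
    _ = _ := by rw [lintegral_mul_const'' _ ha, pow_two, mul_assoc]

open scoped ENNReal in
/-- The convolution of `k` with `f`, where `f` is estimated in `L¹` on `A` and in `L²` off `A`. -/
lemma lintegral_sq_conv_le_split {k f : E2 → ℝ≥0∞} (hk : AEMeasurable k) (hf : AEMeasurable f)
    {A : Set E2} (hA : MeasurableSet A) :
    ∫⁻ x, (∫⁻ y, k y * f (x - y)) ^ 2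
      ≤ 2 * ((∫⁻ y, k y) ^ 2 * ∫⁻ y in Aᶜ, f y ^ 2)
        + 2 * ((∫⁻ y, k y ^ 2) * (volume A * ∫⁻ y, f y ^ 2)) := by
  have hin : AEMeasurable (A.indicator f) := hf.indicator hA
  have hout : AEMeasurable (Aᶜ.indicator f) := hf.indicator hA.compl
  have hsplit : ∀ x, ∫⁻ y, k y * f (x - y)
      = (∫⁻ y, k y * Aᶜ.indicator f (x - y)) + ∫⁻ y, A.indicator f y * k (x - y) := by
    intro x
    have h1 : AEMeasurable (fun y => Aᶜ.indicator f (x - y)) :=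
      hout.comp_quasiMeasurePreserving
        (quasiMeasurePreserving_sub_left_of_right_invariant volume x)
    rw [← lintegral_sub_left_eq_self (fun y => A.indicator f y * k (x - y)) x,
      ← lintegral_add_left' (f := fun y => k y * Aᶜ.indicator f (x - y)) (hk.mul h1)]
    refine lintegral_congr fun y => ?_
    rw [sub_sub_cancel, mul_comm (A.indicator f (x - y)), ← mul_add]
    congr 1
    by_cases h : x - y ∈ A <;> simp [h]
  have hsq : ∀ s t : ℝ≥0∞, (s + t) ^ 2 ≤ 2 * s ^ 2 + 2 * t ^ 2 := fun s t => by
    have h := ENNReal.rpow_add_le_mul_rpow_add_rpow s t (p := 2) (by norm_num)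
    norm_num at h
    rwa [mul_add] at h
  have hL1 : (∫⁻ y, A.indicator f y) ^ 2 ≤ volume A * ∫⁻ y, f y ^ 2 := by
    rw [lintegral_indicator hA]
    have h := sq_lintegral_mul_le (μ := volume.restrict A)
      (aemeasurable_const (b := (1 : ℝ≥0∞))) hf.restrict
    simp only [one_mul, one_pow, lintegral_one, Measure.restrict_apply_univ] at h
    exact h.trans (by gcongr; exact Measure.restrict_le_self)
  have hL2 : ∫⁻ y, Aᶜ.indicator f y ^ 2 = ∫⁻ y in Aᶜ, f y ^ 2 := by
    rw [← lintegral_indicator hA.compl]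
    refine lintegral_congr fun y => ?_
    by_cases h : y ∈ A <;> simp [h]
  have hmeas : AEMeasurable (fun x => 2 * (∫⁻ y, k y * Aᶜ.indicator f (x - y)) ^ 2) := by
    have hprod : AEMeasurable (Function.uncurry fun x y : E2 => k y * Aᶜ.indicator f (x - y))
        (volume.prod volume) :=
      (hk.comp_quasiMeasurePreserving Measure.quasiMeasurePreserving_snd).mul
        (hout.comp_quasiMeasurePreserving
          (quasiMeasurePreserving_sub_of_right_invariant volume volume))
    exact (hprod.lintegral_prod_right'.pow_const 2).const_mul 2
  calc ∫⁻ x, (∫⁻ y, k y * f (x - y)) ^ 2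
      ≤ ∫⁻ x, (2 * (∫⁻ y, k y * Aᶜ.indicator f (x - y)) ^ 2
          + 2 * (∫⁻ y, A.indicator f y * k (x - y)) ^ 2) :=
        lintegral_mono fun x => by rw [hsplit x]; exact hsq _ _
    _ = 2 * (∫⁻ x, (∫⁻ y, k y * Aᶜ.indicator f (x - y)) ^ 2)
          + 2 * ∫⁻ x, (∫⁻ y, A.indicator f y * k (x - y)) ^ 2 := by
        rw [lintegral_add_left' hmeas, lintegral_const_mul' _ _ (by norm_num),
          lintegral_const_mul' _ _ (by norm_num)]
    _ ≤ _ := by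
        gcongr
        · exact (lintegral_sq_conv_le hk hout).trans_eq (by rw [hL2])
        · refine (lintegral_sq_conv_le hin hk).trans ?_
          rw [mul_comm]
          gcongr

/-- Only `‖f‖` needs to be measurable here: the bound survives when the Bochner integral
defining the convolution degenerates to zero. -/
lemma integral_sq_norm_conv_le {k : E2 → ℝ} {f : E2 → E3} (hk : Integrable k)
    (hk2 : Integrable fun y => k y ^ 2) (hf : Integrable fun y => ‖f y‖ ^ 2)
    {A : Set E2} (hA : MeasurableSet A) (hAfin : volume A ≠ ⊤) :
    ∫ x, ‖∫ y, k y • f (x - y)‖ ^ 2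
      ≤ 2 * ((∫ y, |k y|) ^ 2 * ∫ y in Aᶜ, ‖f y‖ ^ 2)
        + 2 * ((∫ y, k y ^ 2) * (volume.real A * ∫ y, ‖f y‖ ^ 2)) := by
  have hfm : AEMeasurable fun y => ‖f y‖ₑ := by
    have h := hf.aestronglyMeasurable.aemeasurable.sqrt.ennreal_ofReal
    simpa only [Real.sqrt_sq (norm_nonneg _), ofReal_norm] using h
  have e1 : ENNReal.ofReal (∫ y, |k y|) = ∫⁻ y, ‖k y‖ₑ := by
    rw [ofReal_integral_eq_lintegral_ofReal hk.abs (ae_of_all _ fun y => abs_nonneg _)]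
    simp only [Real.enorm_eq_ofReal_abs]
  have e2 : ENNReal.ofReal (∫ y, k y ^ 2) = ∫⁻ y, ‖k y‖ₑ ^ 2 := by
    rw [ofReal_integral_eq_lintegral_ofReal hk2 (ae_of_all _ fun y => sq_nonneg _)]
    simp only [Real.enorm_eq_ofReal_abs, ← ENNReal.ofReal_pow (abs_nonneg _), sq_abs]
  have e3 : ∀ s : Set E2,
      ENNReal.ofReal (∫ y in s, ‖f y‖ ^ 2) = ∫⁻ y in s, ‖f y‖ₑ ^ 2 := fun s => by
    rw [ofReal_integral_eq_lintegral_ofReal hf.restrict (ae_of_all _ fun y => sq_nonneg _)]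
    simp only [← ofReal_norm, ← ENNReal.ofReal_pow (norm_nonneg _)]
  have e4 : ENNReal.ofReal (∫ y, ‖f y‖ ^ 2) = ∫⁻ y, ‖f y‖ₑ ^ 2 := by
    simpa using e3 univ
  have n1 : 0 ≤ ∫ y, |k y| := integral_nonneg fun y => abs_nonneg _
  have n2 : 0 ≤ ∫ y, k y ^ 2 := integral_nonneg fun y => sq_nonneg _
  have n3 : ∀ s : Set E2, 0 ≤ ∫ y in s, ‖f y‖ ^ 2 := fun s => integral_nonneg fun y => sq_nonneg _
  have n4 : 0 ≤ ∫ y, ‖f y‖ ^ 2 := integral_nonneg fun y => sq_nonneg _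
  have n5 : 0 ≤ volume.real A := measureReal_nonneg
  have n6 := n3 Aᶜ
  rw [← ENNReal.ofReal_le_ofReal_iff (by positivity)]
  calc ENNReal.ofReal (∫ x, ‖∫ y, k y • f (x - y)‖ ^ 2)
      ≤ ∫⁻ x, ‖∫ y, k y • f (x - y)‖ₑ ^ 2 := by
        refine (Real.ofReal_le_enorm _).trans ((enorm_integral_le_lintegral_enorm _).trans_eq ?_)
        simp only [enorm_pow, enorm_norm]
    _ ≤ ∫⁻ x, (∫⁻ y, ‖k y‖ₑ * ‖f (x - y)‖ₑ) ^ 2 := by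
        gcongr with x
        exact (enorm_integral_le_lintegral_enorm _).trans_eq (by simp only [enorm_smul])
    _ ≤ _ := lintegral_sq_conv_le_split hk.aestronglyMeasurable.enorm hfm hA
    _ = _ := by
        rw [ENNReal.ofReal_add (by positivity) (by positivity),
          ENNReal.ofReal_mul (by positivity), ENNReal.ofReal_mul (by positivity),
          ENNReal.ofReal_mul (by positivity), ENNReal.ofReal_mul (by positivity),
          ENNReal.ofReal_mul (by positivity), ENNReal.ofReal_pow n1, e1, e2, e3, e4,
          ofReal_measureReal hAfin]
        norm_num

/-- `Φ̌` is integrable and square integrable. -/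
lemma integrable_loKer {Φ : E2 → ℝ} (hΦs : ContDiff ℝ (⊤ : ℕ∞) Φ)
    (hΦsupp : ∀ x : E2, 2 ≤ ‖x‖ → Φ x = 0) :
    Integrable (loKer Φ) ∧ Integrable fun y => loKer Φ y ^ 2 := by
  have hcs : HasCompactSupport fun ξ : E2 => (Φ ξ : ℂ) := by
    refine HasCompactSupport.intro (isCompact_closedBall (0 : E2) 2) fun x hx => ?_
    rw [mem_closedBall_zero_iff, not_le] at hx
    simp [hΦsupp x hx.le]
  have hsm : ContDiff ℝ (⊤ : ℕ∞) fun ξ : E2 => (Φ ξ : ℂ) := Complex.ofRealCLM.contDiff.comp hΦs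
  set S : SchwartzMap E2 ℂ := 𝓕⁻ (hcs.toSchwartzMap hsm) with hS
  have hK : loKer Φ = fun y => (S y).re := by
    funext y
    rw [hS, SchwartzMap.fourierInv_coe]
    rfl
  rw [hK]
  exact ⟨S.integrable.re, (S.memLp 2).re.integrable_sq⟩

lemma integral_comp_zpow_smul (F : E2 → ℝ) (k₀ : ℤ) :
    ∫ y : E2, F ((2:ℝ) ^ k₀ • y) = ((4:ℝ) ^ k₀)⁻¹ * ∫ y, F y := by
  have h4 : (4:ℝ) ^ k₀ = ((2:ℝ) ^ k₀) ^ 2 := by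
    rw [← zpow_natCast, zpow_comm]
    norm_num
  have hpos : (0:ℝ) < 2 ^ k₀ := by positivity
  rw [Measure.integral_comp_smul, finrank_euclideanSpace_fin, ← h4, smul_eq_mul,
    abs_of_pos (by positivity)]

lemma integral_sq_norm_Plow_le {Φ : E2 → ℝ} (hΦs : ContDiff ℝ (⊤ : ℕ∞) Φ)
    (hΦsupp : ∀ x : E2, 2 ≤ ‖x‖ → Φ x = 0) (k₀ : ℤ) {f : E2 → E3}
    (hf : Integrable fun y => ‖f y‖ ^ 2)
    {A : Set E2} (hA : MeasurableSet A) (hAfin : volume A ≠ ⊤) :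
    ∫ x, ‖Plow Φ k₀ f x‖ ^ 2
      ≤ 2 * ((∫ y, |loKer Φ y|) ^ 2 * ∫ y in Aᶜ, ‖f y‖ ^ 2)
        + 2 * ((4:ℝ) ^ k₀ * (∫ y, loKer Φ y ^ 2) * (volume.real A * ∫ y, ‖f y‖ ^ 2)) := by
  obtain ⟨h1, h2⟩ := integrable_loKer hΦs hΦsupp
  have h2pos : (2:ℝ) ^ k₀ ≠ 0 := by positivity
  have h4pos : (0:ℝ) < (4:ℝ) ^ k₀ := by positivity
  have hk : Integrable fun y : E2 => (4:ℝ) ^ k₀ * loKer Φ ((2:ℝ) ^ k₀ • y) :=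
    (h1.comp_smul h2pos).const_mul _
  have hk2 : Integrable fun y : E2 => ((4:ℝ) ^ k₀ * loKer Φ ((2:ℝ) ^ k₀ • y)) ^ 2 := by
    simp only [mul_pow]
    exact (h2.comp_smul h2pos).const_mul _
  have i1 : ∫ y : E2, |(4:ℝ) ^ k₀ * loKer Φ ((2:ℝ) ^ k₀ • y)| = ∫ y, |loKer Φ y| := by
    simp only [abs_mul, abs_of_pos h4pos]
    rw [integral_const_mul, integral_comp_zpow_smul fun y => |loKer Φ y|]
    field_simp
  have i2 : ∫ y : E2, ((4:ℝ) ^ k₀ * loKer Φ ((2:ℝ) ^ k₀ • y)) ^ 2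
      = (4:ℝ) ^ k₀ * ∫ y, loKer Φ y ^ 2 := by
    simp only [mul_pow]
    rw [integral_const_mul, integral_comp_zpow_smul fun y => loKer Φ y ^ 2]
    field_simp
  have h := integral_sq_norm_conv_le hk hk2 hf hA hAfin
  rwa [i1, i2] at h

lemma volume_real_annulus {δ : ℝ} (h0 : 0 < δ) (h1 : δ < 1) :
    volume.real (ball (0:E2) (1 + δ) \ ball (0:E2) (1 - δ))
      = 4 * δ * volume.real (ball (0:E2) 1) := by
  have hb : ∀ r : ℝ, 0 ≤ r → volume.real (ball (0:E2) r) = r ^ 2 * volume.real (ball (0:E2) 1) := by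
    intro r hr
    rw [Measure.real, Measure.addHaar_ball _ _ hr, finrank_euclideanSpace_fin, ENNReal.toReal_mul,
      ENNReal.toReal_ofReal (by positivity), Measure.real]
  rw [measureReal_sdiff (ball_subset_ball (by linarith)) measurableSet_ball,
    hb (1 + δ) (by linarith), hb (1 - δ) (by linarith)]
  ring

/-- **Smallness of the low-frequency energy for outgoing data** (bound (3.11)):
there is a constant `C` (universal, given the cutoff `Φ`) such that for every
`δ ∈ (0,1)`, all `(u₀,u₁) ∈ Ḣ¹×L²` with
`‖(u₀,u₁)‖_{Ḣ¹×L²(B₁₊δᶜ ∪ B₁₋δ)} ≤ δ‖(u₀,u₁)‖_{Ḣ¹×L²}`, and every `k₀ ∈ ℤ` with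
`2^{−k₀} ∈ [δ^{1/6}, 2δ^{1/6}]`, one has
`‖P_{≤k₀}(∇u₀, u₁)‖_{L²×L²} ≤ C δ^{1/3} ‖(u₀,u₁)‖_{Ḣ¹×L²}`. -/
theorem low_frequency_energy_small
    (Φ : E2 → ℝ) (hΦs : ContDiff ℝ (⊤ : ℕ∞) Φ)
    (hΦ1 : ∀ x : E2, ‖x‖ ≤ 1 → Φ x = 1)
    (hΦsupp : ∀ x : E2, 2 ≤ ‖x‖ → Φ x = 0)
    (hΦrad : ∀ x y : E2, ‖x‖ = ‖y‖ → Φ x = Φ y) :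
    ∃ C > (0:ℝ), ∀ δ : ℝ, 0 < δ → δ < 1 →
      ∀ u₀ u₁ : E2 → E3,
        Differentiable ℝ u₀ →
        Integrable (fun x : E2 => gradSq u₀ x + ‖u₁ x‖ ^ 2) →
        HLnorm u₀ u₁ ((ball (0:E2) (1 + δ))ᶜ ∪ ball (0:E2) (1 - δ))
          ≤ δ * HLnorm u₀ u₁ univ →
      ∀ k₀ : ℤ, δ ^ ((1:ℝ)/6) ≤ ((2:ℝ) ^ k₀)⁻¹ → ((2:ℝ) ^ k₀)⁻¹ ≤ 2 * δ ^ ((1:ℝ)/6) →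
        Real.sqrt ((∑ i : Fin 2, ∫ x : E2, ‖Plow Φ k₀ (pd u₀ i) x‖ ^ 2)
            + ∫ x : E2, ‖Plow Φ k₀ u₁ x‖ ^ 2)
          ≤ C * δ ^ ((1:ℝ)/3) * HLnorm u₀ u₁ univ := by
  set K₁ := ∫ y, |loKer Φ y|
  set K₂ := ∫ y, loKer Φ y ^ 2
  set V := volume.real (ball (0:E2) 1)
  have hK₂0 : 0 ≤ K₂ := integral_nonneg fun y => sq_nonneg _
  have hV0 : 0 ≤ V := measureReal_nonneg
  refine ⟨Real.sqrt (2 * K₁ ^ 2 + 8 * K₂ * V + 1), by positivity, ?_⟩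
  intro δ h0 h1 u₀ u₁ _ hint hsmall k₀ hk _
  set A : Set E2 := ball (0:E2) (1 + δ) \ ball (0:E2) (1 - δ) with hAdef
  have hA : MeasurableSet A := measurableSet_ball.diff measurableSet_ball
  have hAfin : volume A ≠ ⊤ := measure_ne_top_of_subset sdiff_subset measure_ball_lt_top.ne
  have hAc : (ball (0:E2) (1 + δ))ᶜ ∪ ball (0:E2) (1 - δ) = Aᶜ := by
    rw [hAdef, sdiff_eq, compl_inter, compl_compl]
  rw [hAc] at hsmall
  have hpdm : ∀ i, Measurable (pd u₀ i) := fun i => measurable_fderiv_apply_const ℝ u₀ (sb i)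
  have hpd : ∀ i, Integrable fun x => ‖pd u₀ i x‖ ^ 2 := fun i => by
    refine hint.mono' ((hpdm i).norm.pow_const 2).aestronglyMeasurable (ae_of_all _ fun x => ?_)
    rw [Real.norm_of_nonneg (sq_nonneg _)]
    have := Finset.single_le_sum (f := fun i => ‖pd u₀ i x‖ ^ 2) (fun j _ => sq_nonneg _)
      (Finset.mem_univ i)
    exact this.trans (le_add_of_nonneg_right (sq_nonneg _))
  have hgrad : Integrable fun x => gradSq u₀ x := integrable_finsetSum _ fun i _ => hpd i
  have hu₁ : Integrable fun x => ‖u₁ x‖ ^ 2 := by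
    refine (hint.sub hgrad).congr (ae_of_all _ fun x => ?_)
    simp
  have hsum : ∀ s : Set E2, HLnormSq u₀ u₁ s
      = (∑ i, ∫ x in s, ‖pd u₀ i x‖ ^ 2) + ∫ x in s, ‖u₁ x‖ ^ 2 := fun s => by
    rw [HLnormSq, integral_add hgrad.restrict hu₁.restrict]
    simp only [gradSq]
    rw [integral_finsetSum _ fun i _ => (hpd i).restrict]
  have hnn : ∀ s : Set E2, 0 ≤ HLnormSq u₀ u₁ s := fun s =>
    integral_nonneg fun x => add_nonneg (Finset.sum_nonneg fun i _ => sq_nonneg _) (sq_nonneg _)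
  set E := HLnormSq u₀ u₁ univ with hE
  have hout : HLnormSq u₀ u₁ Aᶜ ≤ δ ^ 2 * E := by
    have h := pow_le_pow_left₀ (Real.sqrt_nonneg _) hsmall 2
    simpa only [mul_pow, HLnorm, Real.sq_sqrt (hnn _)] using h
  have hE0 : 0 ≤ E := hnn univ
  have hVA : volume.real A = 4 * δ * V := volume_real_annulus h0 h1
  set t := δ ^ ((1:ℝ) / 6) with ht
  have ht0 : 0 < t := Real.rpow_pos_of_pos h0 _
  have ht1 : t ≤ 1 := Real.rpow_le_one h0.le h1.le (by norm_num)
  have htδ : δ = t ^ 6 := by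
    rw [ht, ← Real.rpow_natCast, ← Real.rpow_mul h0.le]
    norm_num
  have htt : δ ^ ((1:ℝ) / 3) = t ^ 2 := by
    rw [ht, ← Real.rpow_natCast, ← Real.rpow_mul h0.le]
    norm_num
  have h4 : (4:ℝ) ^ k₀ * δ ≤ t ^ 4 := by
    have e : (4:ℝ) ^ k₀ = ((2:ℝ) ^ k₀) ^ 2 := by
      rw [← zpow_natCast, zpow_comm]
      norm_num
    have hp : (0:ℝ) < 2 ^ k₀ := by positivity
    have h2 : t * 2 ^ k₀ ≤ 1 := by
      calc t * 2 ^ k₀ ≤ ((2:ℝ) ^ k₀)⁻¹ * 2 ^ k₀ := by gcongr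
        _ = 1 := inv_mul_cancel₀ hp.ne'
    calc (4:ℝ) ^ k₀ * δ = (t * 2 ^ k₀) ^ 2 * t ^ 4 := by rw [e, htδ]; ring
      _ ≤ 1 ^ 2 * t ^ 4 := by gcongr
      _ = t ^ 4 := by ring
  have hδ2 : δ ^ 2 ≤ t ^ 4 := by
    rw [htδ, ← pow_mul]
    exact pow_le_pow_of_le_one ht0.le ht1 (by norm_num)
  have hmain : (∑ i : Fin 2, ∫ x : E2, ‖Plow Φ k₀ (pd u₀ i) x‖ ^ 2)
      + ∫ x : E2, ‖Plow Φ k₀ u₁ x‖ ^ 2 ≤ (2 * K₁ ^ 2 + 8 * K₂ * V + 1) * (t ^ 2) ^ 2 * E := by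
    have b := fun i => integral_sq_norm_Plow_le hΦs hΦsupp k₀ (hpd i) hA hAfin
    have b₁ := integral_sq_norm_Plow_le hΦs hΦsupp k₀ hu₁ hA hAfin
    have s1 := hsum Aᶜ
    have s2 := hsum univ
    simp only [Measure.restrict_univ] at s2
    rw [← hE] at s2
    calc _ ≤ 2 * K₁ ^ 2 * HLnormSq u₀ u₁ Aᶜ + 8 * K₂ * V * ((4:ℝ) ^ k₀ * δ) * E := by
          rw [Fin.sum_univ_two] at s1 s2 ⊢
          have b0 := b 0
          have b1 := b 1
          rw [hVA] at b0 b1 b₁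
          rw [s1, s2]
          linarith
      _ ≤ 2 * K₁ ^ 2 * (t ^ 4 * E) + 8 * K₂ * V * t ^ 4 * E := by
          gcongr
          exact hout.trans (by gcongr)
      _ ≤ _ := by
          have : 0 ≤ t ^ 4 * E := by positivity
          linarith
  calc _ ≤ Real.sqrt ((2 * K₁ ^ 2 + 8 * K₂ * V + 1) * (t ^ 2) ^ 2 * E) := Real.sqrt_le_sqrt hmain
    _ = _ := by
      rw [Real.sqrt_mul (by positivity), Real.sqrt_mul (by positivity),
        Real.sqrt_sq (by positivity), htt, HLnorm]
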